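/- arXiv:1910.13763 — 5 statements merged into one kernel-verified Lean document; each statement's English description precedes it below -/
import Mathlib

section
/- Let T' = (t_{i^2})_{i=0}^∞ be the subsequence of the Thue–Morse sequence along the squares. Then for every N ≥ 21, the N-th maximum order complexity of T' satisfies M(T', N) ≥ √(2N/5). Equivalently: for every positive integer M with M < √(2N/5) and every function f : F_2^M → F_2, there exists an index i with 0 ≤ i ≤ N − M − 1 such that t_{(i+M)^2} ≠ f(t_{i^2}, t_{(i+1)^2}, …, t_{(i+M−1)^2}). -/
/-- `patternCount k n` is the number of indices `i ≥ 0` such that the binary digits of `n`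
in positions `i, i+1, …, i+k-1` are all equal to `1`. For `k = 1` this is the binary
digit sum `s₁(n)`. -/
noncomputable def patternCount (k n : ℕ) : ℕ := {i : ℕ | ∀ j < k, n.testBit (i + j)}.ncard

/-- The Thue–Morse sequence over `F₂`: `t n ≡ s₁(n) (mod 2)`. -/
noncomputable def thueMorse (n : ℕ) : ZMod 2 := (patternCount 1 n : ZMod 2)

/-- The pattern sequence `P_k` over `F₂`: `p n ≡ s_k(n) (mod 2)`. -/
noncomputable def patternSeq (k n : ℕ) : ZMod 2 := (patternCount k n : ZMod 2)

theorem finite_setOf_testBit (n : ℕ) : {i : ℕ | n.testBit i = true}.Finite :=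
  (Set.finite_lt_nat n).subset fun _ hi =>
    Nat.lt_two_pow_self.trans_le (Nat.ge_two_pow_of_testBit hi)

theorem patternCount_one (n : ℕ) : patternCount 1 n = {i : ℕ | n.testBit i = true}.ncard := by
  simp [patternCount]

theorem thueMorse_zero : thueMorse 0 = 0 := by
  simp [thueMorse, patternCount_one]

theorem thueMorse_two_mul (n : ℕ) : thueMorse (2 * n) = thueMorse n := by
  have h : {i : ℕ | (2 * n).testBit i = true} = Nat.succ '' {i : ℕ | n.testBit i = true} := by
    ext i
    cases i <;> simp [Nat.testBit_succ]
  rw [thueMorse, thueMorse, patternCount_one, patternCount_one, h,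
    Set.ncard_image_of_injective _ Nat.succ_injective]

theorem thueMorse_two_mul_add_one (n : ℕ) : thueMorse (2 * n + 1) = thueMorse n + 1 := by
  have h : {i : ℕ | (2 * n + 1).testBit i = true} =
      insert 0 (Nat.succ '' {i : ℕ | n.testBit i = true}) := by
    ext i
    cases i with
    | zero => simp
    | succ i =>
      have : (2 * n + 1) / 2 = n := by omega
      simp [Nat.testBit_succ, this]
  rw [thueMorse, thueMorse, patternCount_one, patternCount_one, h,
    Set.ncard_insert_of_notMem (by simp) ((finite_setOf_testBit n).image _),
    Set.ncard_image_of_injective _ Nat.succ_injective]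
  push_cast
  rfl

theorem thueMorse_one : thueMorse 1 = 1 := by
  simpa [thueMorse_zero] using thueMorse_two_mul_add_one 0

theorem thueMorse_two_pow_mul_add (n : ℕ) :
    ∀ a b : ℕ, a < 2 ^ n → thueMorse (2 ^ n * b + a) = thueMorse b + thueMorse a := by
  induction n with
  | zero =>
    intro a b ha
    obtain rfl : a = 0 := by simpa using ha
    simp [thueMorse_zero]
  | succ n ih =>
    intro a b ha
    rw [pow_succ] at ha
    obtain ⟨c, rfl | rfl⟩ := Nat.even_or_odd' a
    · rw [show 2 ^ (n + 1) * b + 2 * c = 2 * (2 ^ n * b + c) by ring, thueMorse_two_mul,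
        thueMorse_two_mul, ih c b (by omega)]
    · rw [show 2 ^ (n + 1) * b + (2 * c + 1) = 2 * (2 ^ n * b + c) + 1 by ring,
        thueMorse_two_mul_add_one, thueMorse_two_mul_add_one, ih c b (by omega), add_assoc]

theorem thueMorse_two_pow_add (n a : ℕ) (ha : a < 2 ^ n) :
    thueMorse (2 ^ n + a) = thueMorse a + 1 := by
  simpa [thueMorse_one, add_comm] using thueMorse_two_pow_mul_add n a 1 ha

theorem thueMorse_two : thueMorse 2 = 1 := by
  simpa [thueMorse_one] using thueMorse_two_mul 1

theorem thueMorse_three : thueMorse 3 = 0 := by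
  simpa [thueMorse_one, CharTwo.add_self_eq_zero] using thueMorse_two_mul_add_one 1

theorem thueMorse_four : thueMorse 4 = 1 := by
  simpa [thueMorse_two] using thueMorse_two_mul 2

/-- The squares of `i + 2 ^ (m + 1)` and `i + 2 ^ (m + 2)` have the same digit-sum parity as long
as the binary expansion of `i ^ 2` does not reach the cross terms. -/
theorem thueMorse_add_two_pow_sq_eq (m i : ℕ) (hm : 2 ≤ m) (hi : i ^ 2 < 2 ^ (m + 2)) :
    thueMorse ((i + 2 ^ (m + 1)) ^ 2) = thueMorse ((i + 2 ^ (m + 2)) ^ 2) := by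
  have hq : 4 ≤ 2 ^ m := (Nat.pow_le_pow_right (by norm_num) hm : 2 ^ 2 ≤ 2 ^ m)
  have hiq : i < 2 ^ m := by
    rw [pow_add] at hi
    nlinarith
  have hiq' : i < 2 ^ (m + 1) := hiq.trans (Nat.pow_lt_pow_right (by norm_num) (by omega))
  rw [show (i + 2 ^ (m + 1)) ^ 2 = 2 ^ (m + 2) * (2 ^ m + i) + i ^ 2 by ring,
    show (i + 2 ^ (m + 2)) ^ 2 = 2 ^ (m + 2) * (2 * (2 ^ (m + 1) + i)) + i ^ 2 by ring,
    thueMorse_two_pow_mul_add _ _ _ hi, thueMorse_two_pow_mul_add _ _ _ hi, thueMorse_two_mul,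
    thueMorse_two_pow_add _ _ hiq, thueMorse_two_pow_add _ _ hiq']

theorem thueMorse_add_two_pow_sq_ne_of_even (r : ℕ) :
    thueMorse ((2 ^ (r + 3) + 1 + 2 ^ (2 * r + 5)) ^ 2) ≠
      thueMorse ((2 ^ (r + 3) + 1 + 2 ^ (2 * r + 6)) ^ 2) := by
  have hG : 1 ≤ 2 ^ r := Nat.one_le_two_pow
  have e : 2 ^ (2 * r) = 2 ^ r * 2 ^ r := by ring
  have h₁ : 2 ^ (r + 4) + 1 < 2 ^ (2 * r + 6) := by
    simp only [pow_add, e]; nlinarith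
  rw [show (2 ^ (r + 3) + 1 + 2 ^ (2 * r + 5)) ^ 2 =
      2 ^ (2 * r + 6) * (2 ^ (2 * r + 4) + (2 ^ (r + 3) + 2)) + (2 ^ (r + 4) + 1) by ring,
    show (2 ^ (r + 3) + 1 + 2 ^ (2 * r + 6)) ^ 2 =
      2 ^ (2 * r + 6) * (2 ^ (2 * r + 6) + (2 ^ (r + 4) + 3)) + (2 ^ (r + 4) + 1) by ring,
    thueMorse_two_pow_mul_add _ _ _ h₁, thueMorse_two_pow_mul_add _ _ _ h₁,
    thueMorse_two_pow_add _ (2 ^ (r + 3) + 2) (by simp only [pow_add, e]; nlinarith),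
    thueMorse_two_pow_add _ 2 (by simp only [pow_add]; omega),
    thueMorse_two_pow_add _ (2 ^ (r + 4) + 3) (by simp only [pow_add, e]; nlinarith),
    thueMorse_two_pow_add _ 3 (by simp only [pow_add]; omega), thueMorse_two, thueMorse_three]
  generalize thueMorse (2 ^ (r + 4) + 1) = x
  revert x
  decide

theorem thueMorse_add_two_pow_sq_ne_of_odd (r : ℕ) :
    thueMorse ((2 ^ (r + 4) + 1 + 2 ^ (2 * r + 6)) ^ 2) ≠
      thueMorse ((2 ^ (r + 4) + 1 + 2 ^ (2 * r + 7)) ^ 2) := by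
  have hG : 1 ≤ 2 ^ r := Nat.one_le_two_pow
  have e : 2 ^ (2 * r) = 2 ^ r * 2 ^ r := by ring
  have h₁ : 2 ^ (r + 5) + 1 < 2 ^ (2 * r + 7) := by
    simp only [pow_add, e]; nlinarith
  rw [show (2 ^ (r + 4) + 1 + 2 ^ (2 * r + 6)) ^ 2 =
      2 ^ (2 * r + 7) * (2 ^ (2 * r + 5) + (2 ^ (r + 4) + 3)) + (2 ^ (r + 5) + 1) by ring,
    show (2 ^ (r + 4) + 1 + 2 ^ (2 * r + 7)) ^ 2 =
      2 ^ (2 * r + 7) * (2 ^ (2 * r + 7) + (2 ^ (r + 5) + 4)) + (2 ^ (r + 5) + 1) by ring,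
    thueMorse_two_pow_mul_add _ _ _ h₁, thueMorse_two_pow_mul_add _ _ _ h₁,
    thueMorse_two_pow_add _ (2 ^ (r + 4) + 3) (by simp only [pow_add, e]; nlinarith),
    thueMorse_two_pow_add _ 3 (by simp only [pow_add]; omega),
    thueMorse_two_pow_add _ (2 ^ (r + 5) + 4) (by simp only [pow_add, e]; nlinarith),
    thueMorse_two_pow_add _ 4 (by simp only [pow_add]; omega), thueMorse_three, thueMorse_four]
  generalize thueMorse (2 ^ (r + 5) + 1) = x
  revert x
  decide

/-- Two equal windows of length `M` with different successors rule out a recurrence of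
order `M`. -/
theorem exists_ne_of_windows_eq {α : Type*} (s : ℕ → α) {M N a b : ℕ}
    (hab : ∀ j < M, s (a + j) = s (b + j)) (hne : s (a + M) ≠ s (b + M))
    (ha : a + M + 1 ≤ N) (hb : b + M + 1 ≤ N) (f : (Fin M → α) → α) :
    ∃ i : ℕ, i + M + 1 ≤ N ∧ s (i + M) ≠ f (fun j => s (i + j.val)) := by
  by_contra! h
  apply hne
  rw [h a ha, h b hb]
  congr 1
  funext j
  exact hab j j.isLt

theorem exists_ne_of_thueMorse_add_two_pow_sq_ne {m k M N : ℕ} (hm : 2 ≤ m)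
    (hM : M ^ 2 ≤ 2 ^ (m + 2))
    (hk : thueMorse ((k + 2 ^ (m + 1)) ^ 2) ≠ thueMorse ((k + 2 ^ (m + 2)) ^ 2))
    (hN : k + 2 ^ (m + 2) + 1 ≤ N) (f : (Fin M → ZMod 2) → ZMod 2) :
    ∃ i : ℕ, i + M + 1 ≤ N ∧
      thueMorse ((i + M) ^ 2) ≠ f (fun j => thueMorse ((i + j.val) ^ 2)) := by
  classical
  have hex : ∃ k, thueMorse ((k + 2 ^ (m + 1)) ^ 2) ≠ thueMorse ((k + 2 ^ (m + 2)) ^ 2) := ⟨k, hk⟩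
  obtain ⟨k₀, hk₀, hmin, hle⟩ : ∃ k₀,
      thueMorse ((k₀ + 2 ^ (m + 1)) ^ 2) ≠ thueMorse ((k₀ + 2 ^ (m + 2)) ^ 2) ∧
      (∀ i < k₀, thueMorse ((i + 2 ^ (m + 1)) ^ 2) = thueMorse ((i + 2 ^ (m + 2)) ^ 2)) ∧
      k₀ ≤ k :=
    ⟨Nat.find hex, Nat.find_spec hex, fun i hi => not_not.mp (Nat.find_min hex hi),
      Nat.find_min' hex hk⟩
  have hMk : M ≤ k₀ := by
    by_contra! hlt
    exact hk₀ (thueMorse_add_two_pow_sq_eq m k₀ hm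
      ((Nat.pow_lt_pow_left hlt (by norm_num)).trans_le hM))
  have hpow : 2 ^ (m + 1) ≤ 2 ^ (m + 2) := Nat.pow_le_pow_right (by norm_num) (by omega)
  obtain ⟨c, rfl⟩ := Nat.exists_eq_add_of_le' hMk
  refine exists_ne_of_windows_eq (fun i => thueMorse (i ^ 2)) (a := c + 2 ^ (m + 1))
    (b := c + 2 ^ (m + 2)) (fun j hj => ?_) ?_ (by omega) (by omega) f
  · simpa only [add_right_comm] using hmin (c + j) (by omega)
  · simpa only [add_right_comm] using hk₀

theorem thueMorse_squares_maxOrderComplexity_of_le_five {M N : ℕ} (hM5 : M ≤ 5)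
    (hN : 21 ≤ N) (hMN : 5 * M ^ 2 < 2 * N) (f : (Fin M → ZMod 2) → ZMod 2) :
    ∃ i : ℕ, i + M + 1 ≤ N ∧
      thueMorse ((i + M) ^ 2) ≠ f (fun j => thueMorse ((i + j.val) ^ 2)) := by
  have t9 : thueMorse 9 = 0 := (thueMorse_two_pow_add 3 1 (by norm_num)).trans
    (by rw [thueMorse_one]; rfl)
  have t25 : thueMorse 25 = 1 := (thueMorse_two_pow_add 4 9 (by norm_num)).trans
    (by rw [t9]; rfl)
  have shift (n a : ℕ) : thueMorse (2 ^ n * a) = thueMorse a := by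
    simpa [thueMorse_zero] using thueMorse_two_pow_mul_add n 0 a (by positivity)
  have t144 : thueMorse 144 = 0 := (shift 4 9).trans t9
  have t400 : thueMorse 400 = 1 := (shift 4 25).trans t25
  have t576 : thueMorse 576 = 0 := (shift 6 9).trans t9
  have t1600 : thueMorse 1600 = 1 := (shift 6 25).trans t25
  by_cases h4 : M ≤ 4
  · exact exists_ne_of_thueMorse_add_two_pow_sq_ne (m := 2) (k := 4) le_rfl
      (Nat.pow_le_pow_left h4 2) (by norm_num [t144, t400]) (by omega) f
  · obtain rfl : M = 5 := by omega
    exact exists_ne_of_thueMorse_add_two_pow_sq_ne (m := 3) (k := 8) (by omega) (by norm_num)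
      (by norm_num [t576, t1600]) (by omega) f

/-- The Nth maximum order complexity of the Thue–Morse sequence along squares is at least
√(2N/5) for N ≥ 21: no recurrence of order M < √(2N/5) can hold on the whole range. -/
theorem thueMorse_squares_maxOrderComplexity (N : ℕ) (hN : 21 ≤ N)
    (M : ℕ) (hM : 0 < M) (hMlt : (M : ℝ) < Real.sqrt (2 * N / 5))
    (f : (Fin M → ZMod 2) → ZMod 2) :
    ∃ i : ℕ, i + M + 1 ≤ N ∧
      thueMorse ((i + M) ^ 2) ≠ f (fun j => thueMorse ((i + j.val) ^ 2)) := by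
  have hMN : 5 * M ^ 2 < 2 * N := by
    have h := (Real.lt_sqrt (Nat.cast_nonneg M)).mp hMlt
    have h' : (5 * M ^ 2 : ℝ) < 2 * N := by linarith
    exact_mod_cast h'
  by_cases hM5 : M ≤ 5
  · exact thueMorse_squares_maxOrderComplexity_of_le_five hM5 hN hMN f
  have hM36 : 36 ≤ M ^ 2 := by nlinarith
  obtain ⟨n, hn, hn'⟩ := exists_nat_pow_near (x := M ^ 2 - 1) (y := 2) (by omega) (by norm_num)
  have hn5 : 5 ≤ n := by
    by_contra! hlt
    have : 2 ^ (n + 1) ≤ 2 ^ 5 := Nat.pow_le_pow_right (by norm_num) (by omega)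
    omega
  obtain ⟨l, rfl⟩ := Nat.exists_eq_add_of_le' hn5
  obtain ⟨r, rfl | rfl⟩ := Nat.even_or_odd' l
  · refine exists_ne_of_thueMorse_add_two_pow_sq_ne (m := 2 * r + 4) (by omega)
      (Nat.le_of_pred_lt hn')
      (thueMorse_add_two_pow_sq_ne_of_even r) ?_ f
    have hG : 2 ^ r ≤ 2 ^ (2 * r) := Nat.pow_le_pow_right (by norm_num) (by omega)
    simp only [pow_add] at hn ⊢
    omega
  · refine exists_ne_of_thueMorse_add_two_pow_sq_ne (m := 2 * r + 5) (by omega)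
      (Nat.le_of_pred_lt hn')
      (thueMorse_add_two_pow_sq_ne_of_odd r) ?_ f
    have hG : 2 ^ r ≤ 2 ^ (2 * r) := Nat.pow_le_pow_right (by norm_num) (by omega)
    simp only [pow_add] at hn ⊢
    omega
end

section
/- For an integer k ≥ 2, let P_k' = (p_{i^2})_{i=0}^∞ be the subsequence of the pattern sequence P_k along the squares. Then for every N ≥ 2^{2k+2}, the N-th maximum order complexity of P_k' satisfies M(P_k', N) ≥ (N/8)^{1/2}. Equivalently: for every positive integer M with M < (N/8)^{1/2} and every function f : F_2^M → F_2, there exists an index i with 0 ≤ i ≤ N − M − 1 such that p_{(i+M)^2} ≠ f(p_{i^2}, p_{(i+1)^2}, …, p_{(i+M−1)^2}). -/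
lemma patternSet_finite {k : ℕ} (hk : 1 ≤ k) (n : ℕ) :
    {i : ℕ | ∀ j < k, n.testBit (i + j)}.Finite := by
  refine (Set.finite_Iio n).subset fun i hi => ?_
  have h := Nat.ge_two_pow_of_testBit (hi 0 hk)
  exact (Nat.lt_two_pow_self (n := i)).trans_le h

/-- A zero digit in position `r` separates the patterns in the low and the high digits. -/
lemma patternCount_two_pow_mul_add {k : ℕ} (hk : 1 ≤ k) (r a b : ℕ) (hb : b < 2 ^ r) :
    patternCount k (2 ^ (r + 1) * a + b) = patternCount k a + patternCount k b := by
  have hb' : b < 2 ^ (r + 1) := hb.trans (Nat.pow_lt_pow_right (by norm_num) (by omega))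
  have hbit : ∀ i, r ≤ i → b.testBit i = false := fun i hi =>
    Nat.testBit_lt_two_pow (hb.trans_le (Nat.pow_le_pow_right (by norm_num) hi))
  have hset : {i : ℕ | ∀ j < k, (2 ^ (r + 1) * a + b).testBit (i + j)} =
      (· + (r + 1)) '' {i : ℕ | ∀ j < k, a.testBit (i + j)} ∪
        {i : ℕ | ∀ j < k, b.testBit (i + j)} := by
    ext i
    simp only [Set.mem_union, Set.mem_image, Set.mem_ofPred_eq,
      Nat.testBit_two_pow_mul_add a hb']
    constructor
    · intro h
      by_cases hi : r + 1 ≤ i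
      · refine Or.inl ⟨i - (r + 1), fun j hj => ?_, by omega⟩
        have h1 := h j hj
        rw [if_neg (by omega)] at h1
        rwa [show i - (r + 1) + j = i + j - (r + 1) by omega]
      · right
        have hik : i + k ≤ r := by
          by_contra hc
          have h1 := h (r - i) (by omega)
          rw [if_pos (by omega), hbit _ (by omega)] at h1
          exact absurd h1 (by simp)
        intro j hj
        have h1 := h j hj
        rwa [if_pos (by omega)] at h1
    · rintro (⟨i', h, rfl⟩ | h) j hj
      · rw [if_neg (by omega), show i' + (r + 1) + j - (r + 1) = i' + j by omega]
        exact h j hj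
      · have h1 := h j hj
        rw [if_pos]
        · exact h1
        · by_contra hc
          rw [hbit _ (by omega)] at h1
          exact absurd h1 (by simp)
  have hdisj : Disjoint ((· + (r + 1)) '' {i : ℕ | ∀ j < k, a.testBit (i + j)})
      {i : ℕ | ∀ j < k, b.testBit (i + j)} := by
    rw [Set.disjoint_left]
    rintro _ ⟨i, -, rfl⟩ h
    have h1 := h 0 hk
    rw [hbit _ (by simp only; omega)] at h1
    exact absurd h1 (by simp)
  unfold patternCount
  rw [hset, Set.ncard_union_eq hdisj ((patternSet_finite hk a).image _) (patternSet_finite hk b),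
    Set.ncard_image_of_injective _ (add_left_injective _)]

lemma patternCount_two_pow_sub_one {k : ℕ} (hk : 1 ≤ k) (n : ℕ) :
    patternCount k (2 ^ n - 1) = n + 1 - k := by
  have hset : {i : ℕ | ∀ j < k, (2 ^ n - 1).testBit (i + j)} =
      (Finset.range (n + 1 - k) : Set ℕ) := by
    ext i
    simp only [Set.mem_ofPred_eq, Nat.testBit_two_pow_sub_one, decide_eq_true_eq,
      Finset.coe_range, Set.mem_Iio]
    constructor
    · intro h
      have := h (k - 1) (by omega)
      omega
    · intro h j hj
      omega
  rw [patternCount, hset, Set.ncard_coe_finset, Finset.card_range]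

lemma patternCount_one_s1 {k : ℕ} (hk : 2 ≤ k) : patternCount k 1 = 0 := by
  have h := patternCount_two_pow_sub_one (by omega : 1 ≤ k) 1
  norm_num at h
  omega

lemma patternCount_two_pow_add_sq {k : ℕ} (hk : 1 ≤ k) (m j : ℕ) (hm : 2 ≤ m)
    (hj : j < 2 ^ (m - 2)) (hjm : j ^ 2 < 2 ^ m) :
    patternCount k ((2 ^ m + j) ^ 2) =
      patternCount k 1 + patternCount k j + patternCount k (j ^ 2) := by
  obtain ⟨q, rfl⟩ := Nat.exists_eq_add_of_le' hm
  have h : (2 ^ (q + 2) + j) ^ 2 = 2 ^ (q + 2 + 1) * (2 ^ (q + 1) * 1 + j) + j ^ 2 := by ring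
  rw [h, patternCount_two_pow_mul_add hk _ _ _ hjm,
    patternCount_two_pow_mul_add hk q _ _ (by simpa using hj)]

lemma patternCount_two_pow_succ_sub_one_sq {k : ℕ} (hk : 2 ≤ k) (m : ℕ) :
    patternCount k ((2 ^ m + (2 ^ m - 1)) ^ 2) = m + 1 - k := by
  obtain ⟨c, hc⟩ := Nat.exists_eq_add_of_le' (Nat.one_le_two_pow (n := m))
  have h : (2 ^ m + (2 ^ m - 1)) ^ 2 = 2 ^ (m + 1 + 1) * (2 ^ m - 1) + 1 := by
    rw [pow_succ 2 (m + 1), pow_succ 2 m, hc, Nat.add_sub_cancel]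
    ring
  rw [h, patternCount_two_pow_mul_add (by omega) _ _ _ (Nat.one_lt_two_pow (by omega)),
    patternCount_two_pow_sub_one (by omega), patternCount_one_s1 hk, add_zero]

lemma patternCount_three_mul_two_pow_sub_one_sq {k : ℕ} (hk : 2 ≤ k) (q : ℕ) :
    patternCount k ((2 ^ (q + 3 + 1) + (2 ^ (q + 3) - 1)) ^ 2) = q + 1 - k := by
  obtain ⟨c, hc⟩ := Nat.exists_eq_add_of_le' (Nat.one_le_two_pow (n := q))
  have h : (2 ^ (q + 3 + 1) + (2 ^ (q + 3) - 1)) ^ 2 =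
      2 ^ (q + 3 + 1) * (2 ^ (1 + 1) * (2 ^ (q + 2 + 1) * 1 + (2 ^ q - 1)) + 1) + 1 := by
    rw [show 2 ^ (q + 3) - 1 = 8 * c + 7 by rw [pow_add, hc]; omega]
    simp only [pow_add, hc, Nat.add_sub_cancel]
    ring
  have hq : 2 ^ q - 1 < 2 ^ (q + 2) := by
    rw [pow_add]
    omega
  rw [h, patternCount_two_pow_mul_add (by omega) _ _ _ (Nat.one_lt_two_pow (by omega)),
    patternCount_two_pow_mul_add (by omega) _ _ _ (by norm_num),
    patternCount_two_pow_mul_add (by omega) _ _ _ hq,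
    patternCount_two_pow_sub_one (by omega), patternCount_one_s1 hk]
  omega

lemma patternSeq_two_pow_add_sq_eq {k : ℕ} (hk : 1 ≤ k) {m j : ℕ} (hm : 4 ≤ m)
    (hj : j ^ 2 < 2 ^ m) :
    patternSeq k ((2 ^ m + j) ^ 2) = patternSeq k ((2 ^ (m + 1) + j) ^ 2) := by
  have hj' : j < 2 ^ (m - 2) := by
    refine lt_of_pow_lt_pow_left₀ 2 (by positivity) (hj.trans_le ?_)
    rw [← pow_mul]
    exact Nat.pow_le_pow_right (by norm_num) (by omega)
  unfold patternSeq
  rw [patternCount_two_pow_add_sq hk m j (by omega) hj' hj,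
    patternCount_two_pow_add_sq hk (m + 1) j (by omega)
      (hj'.trans_le (Nat.pow_le_pow_right (by norm_num) (by omega)))
      (hj.trans_le (Nat.pow_le_pow_right (by norm_num) (by omega)))]

lemma patternSeq_two_pow_add_sq_ne {k m : ℕ} (hk : 2 ≤ k) (hm : k + 2 ≤ m) :
    patternSeq k ((2 ^ m + (2 ^ m - 1)) ^ 2) ≠
      patternSeq k ((2 ^ (m + 1) + (2 ^ m - 1)) ^ 2) := by
  obtain ⟨q, rfl⟩ := Nat.exists_eq_add_of_le' (show 3 ≤ m by omega)
  unfold patternSeq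
  rw [patternCount_two_pow_succ_sub_one_sq hk, patternCount_three_mul_two_pow_sub_one_sq hk,
    Ne, ZMod.natCast_eq_natCast_iff']
  omega

/-- The Nth maximum order complexity of the pattern sequence  (k ≥ 2) along squares
is at least (N/8)^{1/2} for N ≥ 2^{2k+2}. -/
theorem patternSeq_squares_maxOrderComplexity (k : ℕ) (hk : 2 ≤ k)
    (N : ℕ) (hN : 2 ^ (2 * k + 2) ≤ N)
    (M : ℕ) (hM : 0 < M) (hMlt : (M : ℝ) < Real.sqrt (N / 8))
    (f : (Fin M → ZMod 2) → ZMod 2) :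
    ∃ i : ℕ, i + M + 1 ≤ N ∧
      patternSeq k ((i + M) ^ 2) ≠ f (fun j => patternSeq k ((i + j.val) ^ 2)) := by
  have hN0 : N ≠ 0 := by
    have : 0 < 2 ^ (2 * k + 2) := by positivity
    omega
  obtain ⟨m, hm⟩ : ∃ m, Nat.log 2 N = m + 2 := by
    have := Nat.le_log_of_pow_le (by norm_num) hN
    exact ⟨Nat.log 2 N - 2, by omega⟩
  have hkm : 2 * k ≤ m := by
    have := Nat.le_log_of_pow_le (by norm_num) hN
    omega
  have hlow : 2 ^ (m + 2) ≤ N := hm ▸ Nat.pow_log_le_self 2 hN0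
  have hupp : N < 2 ^ (m + 3) := by
    have := Nat.lt_pow_succ_log_self (b := 2) (by norm_num) N
    rwa [hm] at this
  have hM2 : M ^ 2 < 2 ^ m := by
    have h1 : (M : ℝ) ^ 2 < N / 8 := (Real.lt_sqrt (Nat.cast_nonneg M)).1 hMlt
    have h2 : M ^ 2 * 8 < N := by
      rw [lt_div_iff₀ (by norm_num)] at h1
      exact_mod_cast h1
    rw [pow_add] at hupp
    omega
  have hex : ∃ j, patternSeq k ((2 ^ m + j) ^ 2) ≠ patternSeq k ((2 ^ (m + 1) + j) ^ 2) :=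
    ⟨_, patternSeq_two_pow_add_sq_ne hk (by omega)⟩
  classical
  obtain ⟨J, hJ, hmin, hle⟩ : ∃ J,
      patternSeq k ((2 ^ m + J) ^ 2) ≠ patternSeq k ((2 ^ (m + 1) + J) ^ 2) ∧
      (∀ j < J, patternSeq k ((2 ^ m + j) ^ 2) = patternSeq k ((2 ^ (m + 1) + j) ^ 2)) ∧
      J ≤ 2 ^ m - 1 :=
    ⟨Nat.find hex, Nat.find_spec hex, fun j hj => not_not.1 (Nat.find_min hex hj),
      Nat.find_min' hex (patternSeq_two_pow_add_sq_ne hk (by omega))⟩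
  have hMJ : M ≤ J := by
    by_contra hc
    refine hJ (patternSeq_two_pow_add_sq_eq (by omega) (by omega) (lt_of_le_of_lt ?_ hM2))
    exact Nat.pow_le_pow_left (by omega) 2
  obtain ⟨d, rfl⟩ := Nat.exists_eq_add_of_le' hMJ
  have hpos := Nat.one_le_two_pow (n := m)
  rw [pow_add] at hlow
  by_contra! hf
  have h1 := hf (2 ^ m + d) (by omega)
  have h2 := hf (2 ^ (m + 1) + d) (by rw [pow_succ]; omega)
  simp only [add_assoc] at h1 h2
  refine hJ (h1.trans (Eq.trans (congrArg f (funext fun j => ?_)) h2.symm))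
  exact hmin (d + j) (by omega)
end

section
/- Let k > 2 be an even integer and ℓ ≥ 1 an integer. Then s_k(((2^k − 1)·2^ℓ + 2^{2k−1+ℓ})^2) = k and s_k(((2^k − 1)·2^ℓ + 2^{2k+ℓ})^2) = 1; consequently, since k is even, p_{((2^k−1)·2^ℓ + 2^{2k−1+ℓ})^2} ≠ p_{((2^k−1)·2^ℓ + 2^{2k+ℓ})^2}. -/
/-- The binary digits of the first square: two isolated ones and a run of length `2k - 1`,
where `k = c + 1`. -/
theorem testBit_sq_two_pow_two_mul_sub_one {c : ℕ} (hc : 1 ≤ c) (ℓ j : ℕ) :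
    (((2 ^ (c + 1) - 1) * 2 ^ ℓ + 2 ^ (2 * (c + 1) - 1 + ℓ)) ^ 2).testBit j = true ↔
      j = 2 * ℓ ∨ (2 * ℓ + c + 2 ≤ j ∧ j < 2 * ℓ + 3 * c + 3) ∨ j = 2 * ℓ + 4 * c + 2 := by
  have key : ((2 ^ (c + 1) - 1) * 2 ^ ℓ + 2 ^ (2 * (c + 1) - 1 + ℓ)) ^ 2 =
      2 ^ (2 * ℓ) * (2 ^ (c + 2) * (2 ^ (3 * c) * 2 ^ 0 + (2 ^ (2 * c + 1) - 1)) + 2 ^ 0)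
        + 0 := by
    have e : 2 * (c + 1) - 1 = 2 * c + 1 := by omega
    rw [e]
    zify [Nat.one_le_two_pow (n := c + 1), Nat.one_le_two_pow (n := 2 * c + 1)]
    ring
  have h1 : 2 ^ (2 * c + 1) - 1 < 2 ^ (3 * c) := by
    have : 2 ^ (2 * c + 1) ≤ 2 ^ (3 * c) := Nat.pow_le_pow_right two_pos (by omega)
    have := Nat.one_le_two_pow (n := 2 * c + 1)
    omega
  have h2 : 2 ^ 0 < 2 ^ (c + 2) := Nat.pow_lt_pow_right one_lt_two (by omega)
  rw [key, Nat.testBit_two_pow_mul_add _ (by positivity), Nat.testBit_two_pow_mul_add _ h2,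
    Nat.testBit_two_pow_mul_add _ h1]
  simp only [Nat.testBit_two_pow_sub_one, Nat.testBit_two_pow, Nat.zero_testBit]
  split_ifs <;> grind

/-- The binary digits of the second square: two isolated ones and two runs, of lengths `k - 1`
and `k`, separated by a single zero, where `k = c + 1`. -/
theorem testBit_sq_two_pow_two_mul (c ℓ j : ℕ) :
    (((2 ^ (c + 1) - 1) * 2 ^ ℓ + 2 ^ (2 * (c + 1) + ℓ)) ^ 2).testBit j = true ↔
      j = 2 * ℓ ∨ (2 * ℓ + c + 2 ≤ j ∧ j < 2 * ℓ + 2 * c + 2) ∨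
        (2 * ℓ + 2 * c + 3 ≤ j ∧ j < 2 * ℓ + 3 * c + 4) ∨ j = 2 * ℓ + 4 * c + 4 := by
  have key : ((2 ^ (c + 1) - 1) * 2 ^ ℓ + 2 ^ (2 * (c + 1) + ℓ)) ^ 2 =
      2 ^ (2 * ℓ) * (2 ^ (c + 2) * (2 ^ (c + 1) * (2 ^ (2 * c + 1) * 2 ^ 0 + (2 ^ (c + 1) - 1))
        + (2 ^ c - 1)) + 2 ^ 0) + 0 := by
    zify [Nat.one_le_two_pow (n := c + 1), Nat.one_le_two_pow (n := c)]
    ring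
  have h1 : 2 ^ (c + 1) - 1 < 2 ^ (2 * c + 1) := by
    have : 2 ^ (c + 1) ≤ 2 ^ (2 * c + 1) := Nat.pow_le_pow_right two_pos (by omega)
    have := Nat.one_le_two_pow (n := c + 1)
    omega
  have h2 : 2 ^ c - 1 < 2 ^ (c + 1) := by
    have := Nat.one_le_two_pow (n := c)
    omega
  have h3 : 2 ^ 0 < 2 ^ (c + 2) := Nat.pow_lt_pow_right one_lt_two (by omega)
  rw [key, Nat.testBit_two_pow_mul_add _ (by positivity), Nat.testBit_two_pow_mul_add _ h3,
    Nat.testBit_two_pow_mul_add _ h2, Nat.testBit_two_pow_mul_add _ h1]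
  simp only [Nat.testBit_two_pow_sub_one, Nat.testBit_two_pow, Nat.zero_testBit]
  split_ifs <;> grind

theorem patternSeq_even_k_distinguishing_values (k : ℕ) (hk : 2 < k) (hkeven : Even k)
    (ℓ : ℕ) (hℓ : 1 ≤ ℓ) :
    patternCount k (((2 ^ k - 1) * 2 ^ ℓ + 2 ^ (2 * k - 1 + ℓ)) ^ 2) = k ∧
    patternCount k (((2 ^ k - 1) * 2 ^ ℓ + 2 ^ (2 * k + ℓ)) ^ 2) = 1 ∧
    patternSeq k (((2 ^ k - 1) * 2 ^ ℓ + 2 ^ (2 * k - 1 + ℓ)) ^ 2)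
      ≠ patternSeq k (((2 ^ k - 1) * 2 ^ ℓ + 2 ^ (2 * k + ℓ)) ^ 2) := by
  have first : patternCount k (((2 ^ k - 1) * 2 ^ ℓ + 2 ^ (2 * k - 1 + ℓ)) ^ 2) = k := by
    obtain ⟨c, rfl⟩ : ∃ c, k = c + 1 := ⟨k - 1, by omega⟩
    simp only [patternCount, testBit_sq_two_pow_two_mul_sub_one (show 1 ≤ c by omega)]
    have : {i : ℕ | ∀ j < c + 1, i + j = 2 * ℓ ∨
        (2 * ℓ + c + 2 ≤ i + j ∧ i + j < 2 * ℓ + 3 * c + 3) ∨ i + j = 2 * ℓ + 4 * c + 2} =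
        Finset.Ico (2 * ℓ + c + 2) (2 * ℓ + 2 * c + 3) := by
      ext i
      simp only [Set.mem_ofPred_eq, Finset.coe_Ico, Set.mem_Ico]
      constructor
      · intro h
        have h0 := h 0 (by omega)
        have h1 := h 1 (by omega)
        have h2 := h c (by omega)
        omega
      · intro h j hj
        omega
    rw [this, Set.ncard_coe_finset, Nat.card_Ico]
    omega
  have second : patternCount k (((2 ^ k - 1) * 2 ^ ℓ + 2 ^ (2 * k + ℓ)) ^ 2) = 1 := by
    obtain ⟨c, rfl⟩ : ∃ c, k = c + 1 := ⟨k - 1, by omega⟩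
    simp only [patternCount, testBit_sq_two_pow_two_mul]
    rw [Set.ncard_eq_one]
    refine ⟨2 * ℓ + 2 * c + 3, ?_⟩
    ext i
    simp only [Set.mem_ofPred_eq, Set.mem_singleton_iff]
    constructor
    · intro h
      have h0 := h 0 (by omega)
      have h1 := h 1 (by omega)
      have h2 := h c (by omega)
      have h3 := h (2 * ℓ + 2 * c + 2 - i)
      omega
    · intro h j hj
      omega
  refine ⟨first, second, ?_⟩
  rw [patternSeq, patternSeq, first, second, (ZMod.natCast_eq_zero_iff_even).2 hkeven]
  simp
end

section
/- For every integer ℓ ≥ 1, one has s_3((7·2^{ℓ+3} + 2^{ℓ+5})^2) = 2 and s_3((7·2^{ℓ+3} + 2^{ℓ+6})^2) = 1; consequently p_{(7·2^{ℓ+3}+2^{ℓ+5})^2} ≠ p_{(7·2^{ℓ+3}+2^{ℓ+6})^2}, where (p_n) is the pattern sequence P_3. -/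
theorem patternCount_mul_two_pow {k : ℕ} (hk : 0 < k) (m e : ℕ) :
    patternCount k (m * 2 ^ e) = patternCount k m := by
  have h : {i : ℕ | ∀ j < k, (m * 2 ^ e).testBit (i + j)} =
      (· + e) '' {i : ℕ | ∀ j < k, m.testBit (i + j)} := by
    ext i
    simp only [Set.mem_ofPred_eq, Set.mem_image, Nat.testBit_mul_two_pow, Bool.and_eq_true,
      decide_eq_true_eq]
    constructor
    · intro h
      have hi : e ≤ i := (h 0 hk).1
      refine ⟨i - e, fun j hj => ?_, Nat.sub_add_cancel hi⟩
      rw [← Nat.sub_add_comm hi]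
      exact (h j hj).2
    · rintro ⟨a, ha, rfl⟩ j hj
      refine ⟨by omega, ?_⟩
      rw [show a + e + j - e = a + j by omega]
      exact ha j hj
  rw [patternCount, h, Set.ncard_image_of_injective _ (add_left_injective e), patternCount]

theorem patternCount_eq_card_filter {k : ℕ} (hk : 0 < k) {m b : ℕ} (hm : m < 2 ^ b) :
    patternCount k m = {i ∈ Finset.range b | ∀ j < k, m.testBit (i + j)}.card := by
  rw [patternCount, ← Set.ncard_coe_finset]
  congr 1
  ext i
  simp only [Set.mem_ofPred_eq, Finset.coe_filter, Finset.mem_range, iff_and_self]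
  intro h
  by_contra! hi
  have hlt : m < 2 ^ i := hm.trans_le (Nat.pow_le_pow_right two_pos hi)
  simpa [Nat.testBit_lt_two_pow hlt] using h 0 hk

theorem patternSeq_three_distinguishing_values (ℓ : ℕ) (hℓ : 1 ≤ ℓ) :
    patternCount 3 ((7 * 2 ^ (ℓ + 3) + 2 ^ (ℓ + 5)) ^ 2) = 2 ∧
    patternCount 3 ((7 * 2 ^ (ℓ + 3) + 2 ^ (ℓ + 6)) ^ 2) = 1 ∧
    patternSeq 3 ((7 * 2 ^ (ℓ + 3) + 2 ^ (ℓ + 5)) ^ 2)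
      ≠ patternSeq 3 ((7 * 2 ^ (ℓ + 3) + 2 ^ (ℓ + 6)) ^ 2) := by
  have h₁ : patternCount 3 ((7 * 2 ^ (ℓ + 3) + 2 ^ (ℓ + 5)) ^ 2) = 2 := by
    rw [show (7 * 2 ^ (ℓ + 3) + 2 ^ (ℓ + 5)) ^ 2 = 121 * 2 ^ (2 * ℓ + 6) by ring,
      patternCount_mul_two_pow three_pos,
      patternCount_eq_card_filter three_pos (b := 7) (by norm_num)]
    decide
  have h₂ : patternCount 3 ((7 * 2 ^ (ℓ + 3) + 2 ^ (ℓ + 6)) ^ 2) = 1 := by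
    rw [show (7 * 2 ^ (ℓ + 3) + 2 ^ (ℓ + 6)) ^ 2 = 225 * 2 ^ (2 * ℓ + 6) by ring,
      patternCount_mul_two_pow three_pos,
      patternCount_eq_card_filter three_pos (b := 8) (by norm_num)]
    decide
  refine ⟨h₁, h₂, ?_⟩
  rw [patternSeq, patternSeq, h₁, h₂]
  decide
end

section
/- Let k > 3 be an odd integer and ℓ ≥ 1 an integer. Then s_k(((2^{k−1} − 1)·2^{ℓ+2} + 2^{2k−1+ℓ})^2) = k − 2 and s_k(((2^{k−1} − 1)·2^{ℓ+2} + 2^{2k+ℓ})^2) = 0; consequently, since k is odd, p_{((2^{k−1}−1)·2^{ℓ+2} + 2^{2k−1+ℓ})^2} ≠ p_{((2^{k−1}−1)·2^{ℓ+2} + 2^{2k+ℓ})^2}. -/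
theorem Nat.cast_two_pow_sub_one (a : ℕ) : ((2 ^ a - 1 : ℕ) : ℤ) = 2 ^ a - 1 := by
  rw [Nat.cast_sub Nat.one_le_two_pow]
  push_cast
  rfl

theorem sq_shifted_ones_add_two_pow_eq (m ℓ : ℕ) :
    ((2 ^ (m + 3) - 1) * 2 ^ (ℓ + 2) + 2 ^ (2 * m + 7 + ℓ)) ^ 2 =
      2 ^ (2 * ℓ + 4) * (2 ^ (m + 4) * (2 ^ (3 * m + 6) * 1 + (2 ^ (2 * m + 5) - 1)) + 1) := by
  zify
  simp only [Nat.cast_two_pow_sub_one]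
  ring

theorem sq_shifted_ones_add_two_pow_succ_eq (m ℓ : ℕ) :
    ((2 ^ (m + 3) - 1) * 2 ^ (ℓ + 2) + 2 ^ (2 * m + 8 + ℓ)) ^ 2 =
      2 ^ (2 * ℓ + 4) * (2 ^ (m + 4) * (2 ^ (m + 3) *
        (2 ^ (2 * m + 5) * 1 + (2 ^ (m + 3) - 1)) + (2 ^ (m + 2) - 1)) + 1) := by
  zify
  simp only [Nat.cast_two_pow_sub_one]
  ring

theorem Nat.two_pow_sub_one_lt_two_pow {a b : ℕ} (h : a ≤ b) : 2 ^ a - 1 < 2 ^ b :=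
  (Nat.sub_lt (Nat.two_pow_pos a) one_pos).trans_le (Nat.pow_le_pow_right two_pos h)

theorem testBit_sq_shifted_ones_add_two_pow (m ℓ i : ℕ) :
    (((2 ^ (m + 3) - 1) * 2 ^ (ℓ + 2) + 2 ^ (2 * m + 7 + ℓ)) ^ 2).testBit i = true ↔
      i = 2 * ℓ + 4 ∨ (2 * ℓ + m + 8 ≤ i ∧ i < 2 * ℓ + 3 * m + 13) ∨
        i = 2 * ℓ + 4 * m + 14 := by
  rw [sq_shifted_ones_add_two_pow_eq, Nat.testBit_two_pow_mul,
    Nat.testBit_two_pow_mul_add _ (Nat.one_lt_two_pow (by omega)),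
    Nat.testBit_two_pow_mul_add _ (Nat.two_pow_sub_one_lt_two_pow (by omega))]
  split_ifs <;> simp [Nat.testBit_two_pow_sub_one, Nat.testBit_one_eq_true_iff_self_eq_zero] <;>
    omega

theorem testBit_sq_shifted_ones_add_two_pow_succ (m ℓ i : ℕ) :
    (((2 ^ (m + 3) - 1) * 2 ^ (ℓ + 2) + 2 ^ (2 * m + 8 + ℓ)) ^ 2).testBit i = true ↔
      i = 2 * ℓ + 4 ∨ (2 * ℓ + m + 8 ≤ i ∧ i < 2 * ℓ + 2 * m + 10) ∨
        (2 * ℓ + 2 * m + 11 ≤ i ∧ i < 2 * ℓ + 3 * m + 14) ∨ i = 2 * ℓ + 4 * m + 16 := by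
  rw [sq_shifted_ones_add_two_pow_succ_eq, Nat.testBit_two_pow_mul,
    Nat.testBit_two_pow_mul_add _ (Nat.one_lt_two_pow (by omega)),
    Nat.testBit_two_pow_mul_add _ (Nat.two_pow_sub_one_lt_two_pow (by omega)),
    Nat.testBit_two_pow_mul_add _ (Nat.two_pow_sub_one_lt_two_pow (by omega))]
  split_ifs <;> simp [Nat.testBit_two_pow_sub_one, Nat.testBit_one_eq_true_iff_self_eq_zero] <;>
    omega

theorem patternCount_sq_shifted_ones_add_two_pow (m ℓ : ℕ) (hm : 0 < m) :
    patternCount (m + 4) (((2 ^ (m + 3) - 1) * 2 ^ (ℓ + 2) + 2 ^ (2 * m + 7 + ℓ)) ^ 2) =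
      m + 2 := by
  have h : {i : ℕ | ∀ j < m + 4, (((2 ^ (m + 3) - 1) * 2 ^ (ℓ + 2) +
      2 ^ (2 * m + 7 + ℓ)) ^ 2).testBit (i + j)} =
      (Finset.Ico (2 * ℓ + m + 8) (2 * ℓ + 2 * m + 10) : Set ℕ) := by
    ext i
    simp only [testBit_sq_shifted_ones_add_two_pow, Set.mem_ofPred_eq, Finset.coe_Ico,
      Set.mem_Ico]
    refine ⟨fun h => ?_, fun h j hj => by omega⟩
    have h0 := h 0 (by omega)
    have h1 := h 1 (by omega)
    have h2 := h 2 (by omega)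
    have hlast := h (m + 3) (by omega)
    omega
  rw [patternCount, h, Set.ncard_coe_finset, Nat.card_Ico]
  omega

theorem patternCount_sq_shifted_ones_add_two_pow_succ (m ℓ : ℕ) :
    patternCount (m + 4) (((2 ^ (m + 3) - 1) * 2 ^ (ℓ + 2) + 2 ^ (2 * m + 8 + ℓ)) ^ 2) = 0 := by
  have h : {i : ℕ | ∀ j < m + 4, (((2 ^ (m + 3) - 1) * 2 ^ (ℓ + 2) +
      2 ^ (2 * m + 8 + ℓ)) ^ 2).testBit (i + j)} = ∅ := by
    ext i
    simp only [testBit_sq_shifted_ones_add_two_pow_succ, Set.mem_ofPred_eq,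
      Set.mem_empty_iff_false, iff_false]
    intro h
    have h0 := h 0 (by omega)
    have h1 := h 1 (by omega)
    have hlast := h (m + 3) (by omega)
    have hgap := h (2 * ℓ + 2 * m + 10 - i)
    omega
  rw [patternCount, h, Set.ncard_empty]

theorem patternSeq_odd_k_distinguishing_values (k : ℕ) (hk : 3 < k) (hkodd : Odd k)
    (ℓ : ℕ) (hℓ : 1 ≤ ℓ) :
    patternCount k (((2 ^ (k - 1) - 1) * 2 ^ (ℓ + 2) + 2 ^ (2 * k - 1 + ℓ)) ^ 2) = k - 2 ∧
    patternCount k (((2 ^ (k - 1) - 1) * 2 ^ (ℓ + 2) + 2 ^ (2 * k + ℓ)) ^ 2) = 0 ∧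
    patternSeq k (((2 ^ (k - 1) - 1) * 2 ^ (ℓ + 2) + 2 ^ (2 * k - 1 + ℓ)) ^ 2)
      ≠ patternSeq k (((2 ^ (k - 1) - 1) * 2 ^ (ℓ + 2) + 2 ^ (2 * k + ℓ)) ^ 2) := by
  obtain ⟨m, rfl⟩ : ∃ m, k = m + 4 := ⟨k - 4, by omega⟩
  have hm : 0 < m := by
    rcases hkodd with ⟨r, hr⟩
    omega
  have hcount := patternCount_sq_shifted_ones_add_two_pow m ℓ hm
  have hcount_succ := patternCount_sq_shifted_ones_add_two_pow_succ m ℓ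
  rw [show m + 4 - 1 = m + 3 by omega, show m + 4 - 2 = m + 2 by omega,
    show 2 * (m + 4) - 1 + ℓ = 2 * m + 7 + ℓ by omega,
    show 2 * (m + 4) + ℓ = 2 * m + 8 + ℓ by omega]
  refine ⟨hcount, hcount_succ, ?_⟩
  rw [patternSeq, patternSeq, hcount, hcount_succ, Nat.cast_zero, Ne, ZMod.natCast_eq_zero_iff]
  rcases hkodd with ⟨r, hr⟩
  omega
end
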